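/- Let $d \geq 1$, $\rho > 0$, $\alpha > -d$, and $\beta, \delta \in \mathbb{R}$. Then there exist constants $0 < c \leq C$ such that for all $v \in \mathbb{R}^d$, $c\,\langle v\rangle^{\alpha+\beta} \leq \int_{\mathbb{R}^d} |v - v_*|^{\alpha} \langle v - v_*\rangle^{\beta} \langle v_*\rangle^{\delta} e^{-\rho |v_*|^2}\, dv_* \leq C\,\langle v\rangle^{\alpha+\beta}$. -/

import Mathlib

open MeasureTheory

/-- The Japanese bracket. -/
noncomputable def jb {d : ℕ} (x : EuclideanSpace ℝ (Fin d)) : ℝ := Real.sqrt (1 + ‖x‖ ^ 2)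

lemma jb_one_le {d : ℕ} (x : EuclideanSpace ℝ (Fin d)) : 1 ≤ jb x := by
  unfold jb
  rw [Real.one_le_sqrt]
  nlinarith [sq_nonneg ‖x‖]

lemma jb_sq {d : ℕ} (x : EuclideanSpace ℝ (Fin d)) : jb x ^ 2 = 1 + ‖x‖ ^ 2 := by
  unfold jb
  rw [Real.sq_sqrt]
  positivity

lemma jb_pos {d : ℕ} (x : EuclideanSpace ℝ (Fin d)) : 0 < jb x :=
  lt_of_lt_of_le one_pos (jb_one_le x)

lemma norm_le_jb {d : ℕ} (x : EuclideanSpace ℝ (Fin d)) : ‖x‖ ≤ jb x := by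
  have h := jb_sq x
  have := jb_pos x
  nlinarith [norm_nonneg x]

/-- Peetre's inequality. -/
lemma jb_peetre {d : ℕ} (x y z : EuclideanSpace ℝ (Fin d)) (h : ‖x‖ ≤ ‖y‖ + ‖z‖) :
    jb x ≤ (2 * jb z) * jb y := by
  have hx := jb_sq x
  have hy := jb_sq y
  have hz := jb_sq z
  have h1 := jb_pos y
  have h2 := jb_pos z
  apply le_of_sq_le_sq _ (by positivity)
  have : (2 * jb z * jb y) ^ 2 = 4 * (jb z ^ 2) * (jb y ^ 2) := by ring
  rw [this, hx, hy, hz]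
  have h3 : ‖x‖ ^ 2 ≤ (‖y‖ + ‖z‖) ^ 2 := by
    have := norm_nonneg x
    gcongr
  nlinarith [sq_nonneg (‖y‖ - ‖z‖), mul_nonneg (sq_nonneg ‖y‖) (sq_nonneg ‖z‖),
    sq_nonneg ‖y‖, sq_nonneg ‖z‖]

lemma rpow_compare {a b k : ℝ} (s : ℝ) (ha : 0 < a) (hb : 0 < b) (hk : 0 < k)
    (h1 : a ≤ k * b) (h2 : b ≤ k * a) : a ^ s ≤ k ^ |s| * b ^ s := by
  rcases le_total 0 s with hs | hs
  · rw [abs_of_nonneg hs, ← Real.mul_rpow hk.le hb.le]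
    exact Real.rpow_le_rpow ha.le h1 hs
  · rw [abs_of_nonpos hs]
    have h3 : b / k ≤ a := by
      rw [div_le_iff₀ hk]; linarith
    have h4 := Real.rpow_le_rpow_of_nonpos (by positivity) h3 hs
    rw [Real.div_rpow hb.le hk.le] at h4
    rw [Real.rpow_neg hk.le]
    calc a ^ s ≤ _ := h4
      _ = _ := by rw [div_eq_mul_inv, mul_comm]

lemma jb_shift {d : ℕ} (s : ℝ) (v w : EuclideanSpace ℝ (Fin d)) :
    jb (v - w) ^ s ≤ (2 * jb w) ^ |s| * jb v ^ s ∧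
    jb v ^ s ≤ (2 * jb w) ^ |s| * jb (v - w) ^ s := by
  have h1 : jb (v - w) ≤ (2 * jb w) * jb v := jb_peetre _ _ _ (norm_sub_le v w)
  have h2 : jb v ≤ (2 * jb w) * jb (v - w) := by
    apply jb_peetre
    calc ‖v‖ = ‖(v - w) + w‖ := by simp
      _ ≤ _ := norm_add_le _ _
  have := jb_pos w
  exact ⟨rpow_compare s (jb_pos _) (jb_pos _) (by positivity) h1 h2,
    rpow_compare s (jb_pos _) (jb_pos _) (by positivity) h2 h1⟩

lemma jb_le_two {d : ℕ} (u : EuclideanSpace ℝ (Fin d)) (hu : 1 ≤ ‖u‖) : jb u ≤ 2 * ‖u‖ := by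
  apply le_of_sq_le_sq _ (by positivity)
  rw [jb_sq]; nlinarith

lemma norm_rpow_compare {d : ℕ} (s : ℝ) (u : EuclideanSpace ℝ (Fin d)) (hu : 1 ≤ ‖u‖) :
    ‖u‖ ^ s ≤ 2 ^ |s| * jb u ^ s ∧ jb u ^ s ≤ 2 ^ |s| * ‖u‖ ^ s := by
  have h1 := norm_le_jb u
  have h2 := jb_le_two u hu
  have h3 := jb_pos u
  exact ⟨rpow_compare s (by linarith) h3 two_pos (by linarith) h2,
    rpow_compare s h3 (by linarith) two_pos h2 (by linarith)⟩

/-- The local singular part. -/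
noncomputable def locSing {d : ℕ} (s : ℝ) : EuclideanSpace ℝ (Fin d) → ℝ :=
  (Metric.ball 0 1).indicator (fun u => ‖u‖ ^ s)

lemma locSing_nonneg {d : ℕ} (s : ℝ) (u : EuclideanSpace ℝ (Fin d)) : 0 ≤ locSing s u := by
  unfold locSing
  apply Set.indicator_nonneg
  intros; positivity

lemma locSing_integrable {d : ℕ} (hd : 1 ≤ d) (s : ℝ) (hs : -(d : ℝ) < s) :
    Integrable (locSing s : EuclideanSpace ℝ (Fin d) → ℝ) := by
  unfold locSing
  rw [integrable_indicator_iff measurableSet_ball]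
  refine integrableOn_ball_of_norm_le_rpow (C := 1) (α := -s) (by simpa using hd)
    (by simp; linarith) ?_ ?_
  · refine Filter.Eventually.of_forall fun x => ?_
    rw [Real.norm_of_nonneg (by positivity)]
    simp
  · exact (by fun_prop : Measurable fun u : EuclideanSpace ℝ (Fin d) => ‖u‖ ^ s).aestronglyMeasurable

lemma norm_rpow_le {d : ℕ} (s : ℝ) (u : EuclideanSpace ℝ (Fin d)) :
    ‖u‖ ^ s ≤ 2 ^ |s| * (1 + locSing s u) * jb u ^ s := by
  have hJ := jb_pos u
  have hJ1 := jb_one_le u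
  by_cases hu : 1 ≤ ‖u‖
  · refine (norm_rpow_compare s u hu).1.trans ?_
    have := locSing_nonneg s u
    gcongr
    have : (0:ℝ) < 2 ^ |s| := by positivity
    nlinarith
  · push Not at hu
    have h1 : locSing s u = ‖u‖ ^ s := by
      unfold locSing
      rw [Set.indicator_of_mem]
      simpa using hu
    have h2 : jb u ≤ 2 := by
      apply le_of_sq_le_sq _ (by positivity)
      rw [jb_sq]; nlinarith [norm_nonneg u]
    have h3 := rpow_compare s one_pos hJ two_pos (by linarith) (by linarith)
    rw [Real.one_rpow] at h3
    rw [h1]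
    have h4 : 0 ≤ ‖u‖ ^ s := by positivity
    nlinarith

lemma gauss_bound {d : ℕ} (ρ m : ℝ) (hρ : 0 < ρ) : ∃ M : ℝ, 0 < M ∧
    ∀ w : EuclideanSpace ℝ (Fin d), jb w ^ m * Real.exp (-ρ * ‖w‖ ^ 2) ≤ M := by
  obtain ⟨n, hn⟩ := exists_nat_ge m
  refine ⟨n.factorial / ρ ^ n * Real.exp ρ, by positivity, fun w => ?_⟩
  have h0 : jb w ^ m ≤ (1 + ‖w‖ ^ 2) ^ n := by
    rw [← jb_sq, ← pow_mul, ← Real.rpow_natCast]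
    apply Real.rpow_le_rpow_of_exponent_le (jb_one_le w)
    push_cast
    have : (0 : ℝ) ≤ n := by positivity
    linarith
  have h1 := Real.pow_div_factorial_le_exp (ρ * (1 + ‖w‖ ^ 2)) (by positivity) n
  rw [div_le_iff₀ (by positivity), mul_pow] at h1
  have h2 : (1 + ‖w‖ ^ 2) ^ n ≤ n.factorial / ρ ^ n * Real.exp (ρ * (1 + ‖w‖ ^ 2)) := by
    rw [div_mul_eq_mul_div, le_div_iff₀ (by positivity)]
    linarith
  calc jb w ^ m * Real.exp (-ρ * ‖w‖ ^ 2)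
      ≤ (n.factorial / ρ ^ n * Real.exp (ρ * (1 + ‖w‖ ^ 2))) * Real.exp (-ρ * ‖w‖ ^ 2) := by
        gcongr; exact h0.trans h2
    _ = _ := by
        rw [mul_assoc, ← Real.exp_add]; congr 2; ring

lemma upper_pointwise {d : ℕ} (ρ α β δ : ℝ) (hρ : 0 < ρ) : ∃ K : ℝ, 0 < K ∧
    ∀ v w : EuclideanSpace ℝ (Fin d),
      ‖v - w‖ ^ α * jb (v - w) ^ β * jb w ^ δ * Real.exp (-ρ * ‖w‖ ^ 2) ≤
        K * jb v ^ (α + β) * (jb w ^ (-((d : ℝ) + 1)) + locSing α (v - w)) := by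
  obtain ⟨M, hM, hb⟩ := gauss_bound (d := d) ρ (|α + β| + δ + (d + 1)) hρ
  refine ⟨2 ^ |α| * 2 ^ |α + β| * M, by positivity, fun v w => ?_⟩
  have hu := jb_pos (v - w)
  have hw := jb_pos w
  have hv := jb_pos v
  have hL := locSing_nonneg α (v - w)
  set G := jb w ^ (-((d : ℝ) + 1)) with hG
  have hG0 : 0 < G := by positivity
  have hG1 : G ≤ 1 := Real.rpow_le_one_of_one_le_of_nonpos (jb_one_le w) (by
    have : (0 : ℝ) ≤ d := by positivity
    linarith)
  have h2 := (jb_shift (α + β) v w).1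
  rw [Real.mul_rpow two_pos.le hw.le] at h2
  have h3 : jb w ^ |α + β| * jb w ^ δ * Real.exp (-ρ * ‖w‖ ^ 2) ≤ M * G := by
    have e : jb w ^ |α + β| * jb w ^ δ = jb w ^ (|α + β| + δ + (d + 1)) * G := by
      rw [hG, ← Real.rpow_add hw, ← Real.rpow_add hw]; congr 1; ring
    rw [e]
    have := mul_le_mul_of_nonneg_right (hb w) hG0.le
    linarith
  calc ‖v - w‖ ^ α * jb (v - w) ^ β * jb w ^ δ * Real.exp (-ρ * ‖w‖ ^ 2)
      ≤ (2 ^ |α| * (1 + locSing α (v - w)) * jb (v - w) ^ α) * jb (v - w) ^ β * jb w ^ δ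
          * Real.exp (-ρ * ‖w‖ ^ 2) := by
        gcongr; exact norm_rpow_le α _
    _ = 2 ^ |α| * (1 + locSing α (v - w)) * jb (v - w) ^ (α + β) * jb w ^ δ
          * Real.exp (-ρ * ‖w‖ ^ 2) := by rw [Real.rpow_add hu]; ring
    _ ≤ 2 ^ |α| * (1 + locSing α (v - w)) * (2 ^ |α + β| * jb w ^ |α + β| * jb v ^ (α + β))
          * jb w ^ δ * Real.exp (-ρ * ‖w‖ ^ 2) := by gcongr
    _ = 2 ^ |α| * 2 ^ |α + β| * jb v ^ (α + β) * (1 + locSing α (v - w)) *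
          (jb w ^ |α + β| * jb w ^ δ * Real.exp (-ρ * ‖w‖ ^ 2)) := by ring
    _ ≤ 2 ^ |α| * 2 ^ |α + β| * jb v ^ (α + β) * (1 + locSing α (v - w)) * (M * G) := by gcongr
    _ = 2 ^ |α| * 2 ^ |α + β| * M * jb v ^ (α + β) * (G + locSing α (v - w) * G) := by ring
    _ ≤ _ := by
        gcongr
        nlinarith

lemma lower_pointwise {d : ℕ} (ρ α β δ : ℝ) (hρ : 0 < ρ) : ∃ c : ℝ, 0 < c ∧
    ∀ v w : EuclideanSpace ℝ (Fin d),
      c * jb v ^ (α + β) * ((Metric.ball 0 2).indicator 1 w - (Metric.ball 0 1).indicator 1 (v - w))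
      ≤ ‖v - w‖ ^ α * jb (v - w) ^ β * jb w ^ δ * Real.exp (-ρ * ‖w‖ ^ 2) := by
  refine ⟨(6 ^ |α + β| * 2 ^ |α| * 3 ^ |δ|)⁻¹ * Real.exp (-ρ * 4), by positivity, fun v w => ?_⟩
  have hu := jb_pos (v - w)
  have hw := jb_pos w
  have hw1 := jb_one_le w
  have hv := jb_pos v
  have hr : 0 ≤ ‖v - w‖ ^ α * jb (v - w) ^ β * jb w ^ δ * Real.exp (-ρ * ‖w‖ ^ 2) := by positivity
  set c := (6 ^ |α + β| * 2 ^ |α| * 3 ^ |δ|)⁻¹ * Real.exp (-ρ * 4) with hc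
  have hc0 : 0 < c := by positivity
  by_cases h1 : w ∈ Metric.ball (0 : EuclideanSpace ℝ (Fin d)) 2
  · by_cases h2 : v - w ∈ Metric.ball (0 : EuclideanSpace ℝ (Fin d)) 1
    · rw [Set.indicator_of_mem h1, Set.indicator_of_mem h2]
      simpa using hr
    · rw [Set.indicator_of_mem h1, Set.indicator_of_notMem h2]
      simp only [Pi.one_apply, sub_zero, mul_one]
      have h1' : ‖w‖ < 2 := by simpa using h1
      have h2' : 1 ≤ ‖v - w‖ := by
        rw [mem_ball_zero_iff] at h2
        exact not_lt.mp h2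
      have hw3 : jb w ≤ 3 := by
        apply le_of_sq_le_sq _ (by positivity)
        rw [jb_sq]; nlinarith [norm_nonneg w]
      have i1 : jb v ^ (α + β) ≤ 6 ^ |α + β| * jb (v - w) ^ (α + β) := by
        refine (jb_shift (α + β) v w).2.trans ?_
        gcongr
        linarith
      have i2 := (norm_rpow_compare α (v - w) h2').2
      have i3 := rpow_compare (k := 3) δ one_pos hw (by norm_num) (by linarith) (by linarith)
      rw [Real.one_rpow] at i3
      have i4 : Real.exp (-ρ * 4) ≤ Real.exp (-ρ * ‖w‖ ^ 2) := by
        apply Real.exp_le_exp.mpr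
        have : ‖w‖ ^ 2 ≤ 4 := by nlinarith [norm_nonneg w]
        nlinarith
      rw [Real.rpow_add hu] at i1
      rw [hc, mul_assoc, inv_mul_le_iff₀ (by positivity)]
      calc Real.exp (-ρ * 4) * jb v ^ (α + β)
          ≤ Real.exp (-ρ * ‖w‖ ^ 2) * (6 ^ |α + β| * ((2 ^ |α| * ‖v - w‖ ^ α) * jb (v - w) ^ β)) := by
            gcongr
            refine i1.trans ?_
            gcongr
        _ ≤ Real.exp (-ρ * ‖w‖ ^ 2) * (6 ^ |α + β| * ((2 ^ |α| * ‖v - w‖ ^ α) * jb (v - w) ^ β))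
              * (3 ^ |δ| * jb w ^ δ) := le_mul_of_one_le_right (by positivity) i3
        _ = _ := by ring
  · rw [Set.indicator_of_notMem h1]
    refine le_trans ?_ hr
    have : (0 : ℝ) ≤ (Metric.ball 0 1).indicator 1 (v - w) :=
      Set.indicator_nonneg (by intros; simp) _
    have h5 : 0 ≤ c * jb v ^ (α + β) := by positivity
    nlinarith

lemma G_integrable {d : ℕ} :
    Integrable (fun w : EuclideanSpace ℝ (Fin d) => jb w ^ (-((d : ℝ) + 1))) := by
  have h := integrable_rpow_neg_one_add_norm_sq (E := EuclideanSpace ℝ (Fin d)) (μ := volume)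
    (r := (d : ℝ) + 1) (by simp)
  refine h.congr (Filter.Eventually.of_forall fun w => ?_)
  simp only
  rw [← jb_sq, ← Real.rpow_natCast, ← Real.rpow_mul (jb_pos w).le]
  congr 1
  push_cast
  ring

lemma ball_ind_integrable {d : ℕ} (r : ℝ) :
    Integrable ((Metric.ball 0 r).indicator (1 : EuclideanSpace ℝ (Fin d) → ℝ)) := by
  rw [integrable_indicator_iff measurableSet_ball]
  exact integrableOn_const (by exact measure_ball_lt_top.ne)

lemma ball_ind_integral {d : ℕ} (r : ℝ) (hr : 0 < r) :
    ∫ w, (Metric.ball 0 r).indicator (1 : EuclideanSpace ℝ (Fin d) → ℝ) w =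
      r ^ d * volume.real (Metric.ball (0 : EuclideanSpace ℝ (Fin d)) 1) := by
  rw [integral_indicator_one measurableSet_ball]
  have := congrArg ENNReal.toReal
    (Measure.addHaar_ball_of_pos (volume : Measure (EuclideanSpace ℝ (Fin d))) 0 hr)
  rw [ENNReal.toReal_mul, ENNReal.toReal_ofReal (by positivity), finrank_euclideanSpace_fin] at this
  exact this

lemma main_aux {d : ℕ} (hd : 1 ≤ d)
    (ρ α β δ : ℝ) (hρ : 0 < ρ) (hα : -(d : ℝ) < α) :
    ∃ c C : ℝ, 0 < c ∧ ∀ v : EuclideanSpace ℝ (Fin d),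
      c * jb v ^ (α + β) ≤
        (∫ w : EuclideanSpace ℝ (Fin d),
          ‖v - w‖ ^ α * jb (v - w) ^ β * jb w ^ δ * Real.exp (-ρ * ‖w‖ ^ 2)) ∧
      (∫ w : EuclideanSpace ℝ (Fin d),
          ‖v - w‖ ^ α * jb (v - w) ^ β * jb w ^ δ * Real.exp (-ρ * ‖w‖ ^ 2)) ≤
        C * jb v ^ (α + β) := by
  obtain ⟨K, hK, hup⟩ := upper_pointwise (d := d) ρ α β δ hρ
  obtain ⟨c, hc, hlow⟩ := lower_pointwise (d := d) ρ α β δ hρ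
  set V := volume.real (Metric.ball (0 : EuclideanSpace ℝ (Fin d)) 1) with hV
  have hVpos : 0 < V :=
    ENNReal.toReal_pos (Metric.measure_ball_pos _ _ one_pos).ne' measure_ball_lt_top.ne
  have h2d : (1 : ℝ) < 2 ^ d := one_lt_pow₀ (by norm_num) (by omega)
  refine ⟨c * (2 ^ d * V - 1 ^ d * V),
    K * ((∫ w : EuclideanSpace ℝ (Fin d), jb w ^ (-((d : ℝ) + 1))) +
      ∫ w : EuclideanSpace ℝ (Fin d), locSing α w), ?_, fun v => ?_⟩
  · apply mul_pos hc
    rw [one_pow, one_mul]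
    nlinarith
  have hLi := (locSing_integrable hd α hα).comp_sub_left v
  have hGi := G_integrable (d := d)
  have hUi := (hGi.add hLi).const_mul (K * jb v ^ (α + β))
  have hIi : Integrable (fun w : EuclideanSpace ℝ (Fin d) =>
      ‖v - w‖ ^ α * jb (v - w) ^ β * jb w ^ δ * Real.exp (-ρ * ‖w‖ ^ 2)) := by
    refine hUi.mono' ?_ (Filter.Eventually.of_forall fun w => ?_)
    · unfold jb
      apply Measurable.aestronglyMeasurable
      fun_prop
    · have := jb_pos w
      have := jb_pos (v - w)
      rw [Real.norm_of_nonneg (by positivity)]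
      exact hup v w
  have hB1 := (ball_ind_integrable (d := d) 1).comp_sub_left v
  have hB2 := ball_ind_integrable (d := d) 2
  constructor
  · have h := integral_mono ((hB2.sub hB1).const_mul (c * jb v ^ (α + β))) hIi (fun w => hlow v w)
    rw [integral_const_mul] at h
    simp only [Pi.sub_apply] at h
    rw [integral_sub hB2 hB1, integral_sub_left_eq_self
      ((Metric.ball 0 1).indicator (1 : EuclideanSpace ℝ (Fin d) → ℝ)) volume v,
      ball_ind_integral 2 (by norm_num), ball_ind_integral 1 (by norm_num)] at h
    refine le_trans (le_of_eq ?_) h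
    ring
  · have h := integral_mono hIi hUi (fun w => hup v w)
    rw [integral_const_mul] at h
    simp only [Pi.add_apply] at h
    rw [integral_add hGi hLi, integral_sub_left_eq_self (locSing α) volume v] at h
    refine h.trans (le_of_eq ?_)
    ring

theorem gaussian_convolution_equivalence {d : ℕ} (hd : 1 ≤ d)
    (ρ α β δ : ℝ) (hρ : 0 < ρ) (hα : -(d : ℝ) < α) :
    ∃ c C : ℝ, 0 < c ∧ c ≤ C ∧ ∀ v : EuclideanSpace ℝ (Fin d),
      c * Real.sqrt (1 + ‖v‖ ^ 2) ^ (α + β) ≤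
        (∫ vs : EuclideanSpace ℝ (Fin d),
          ‖v - vs‖ ^ α * Real.sqrt (1 + ‖v - vs‖ ^ 2) ^ β *
            Real.sqrt (1 + ‖vs‖ ^ 2) ^ δ * Real.exp (-ρ * ‖vs‖ ^ 2)) ∧
      (∫ vs : EuclideanSpace ℝ (Fin d),
          ‖v - vs‖ ^ α * Real.sqrt (1 + ‖v - vs‖ ^ 2) ^ β *
            Real.sqrt (1 + ‖vs‖ ^ 2) ^ δ * Real.exp (-ρ * ‖vs‖ ^ 2)) ≤
        C * Real.sqrt (1 + ‖v‖ ^ 2) ^ (α + β) := by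
  obtain ⟨c, C, hc, h⟩ := main_aux hd ρ α β δ hρ hα
  refine ⟨c, C, hc, ?_, h⟩
  have h0 := (h 0).1.trans (h 0).2
  have : jb (0 : EuclideanSpace ℝ (Fin d)) = 1 := by simp [jb]
  simpa [this] using h0
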